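/- arXiv:2601.19797 — 2 statements merged into one kernel-verified Lean document; each statement's English description precedes it below -/
import Mathlib

section
/- Let ρ satisfy (H0) and have compact support. Then for every v ∈ C_c^∞(ℝ^n; ℝ^n) and every x ∈ ℝ^n, the defining integrals converge absolutely and div_ρ ( (D_ρ v)^T )(x) = D_ρ ( div_ρ v )(x), i.e. the nonlocal divergence of the transposed nonlocal gradient equals the nonlocal gradient of the nonlocal divergence. -/
open MeasureTheory Metric Set Matrix
open scoped ENNReal InnerProductSpace

noncomputable section

/-- Points of `ℝ^n` with the Euclidean norm. -/
abbrev Eu (n : ℕ) := EuclideanSpace ℝ (Fin n)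

/-- Hypothesis (H0): `ρ` is a nonnegative radial kernel (with radial representation `ρb`),
locally integrable, with `∫ min{1,|x|⁻¹} ρ(x) dx < ∞`, and bounded below away from zero
on a closed ball of some radius `ε > 0`. -/
def IsKernelH0 (n : ℕ) (ρ : Eu n → ℝ) (ρb : ℝ → ℝ) (ε : ℝ) : Prop :=
  (∀ x, 0 ≤ ρ x) ∧
  (∀ x : Eu n, x ≠ 0 → ρ x = ρb ‖x‖) ∧
  LocallyIntegrable ρ volume ∧
  Integrable (fun x : Eu n => min 1 ‖x‖⁻¹ * ρ x) volume ∧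
  0 < ε ∧
  ∃ c > (0 : ℝ), ∀ x ∈ closedBall (0 : Eu n) ε, x ≠ 0 → c ≤ ρ x

/-- The auxiliary function `f_ρ(r) = r^(n-2) ρ̄(r)`. -/
def fRho (n : ℕ) (ρb : ℝ → ℝ) (r : ℝ) : ℝ := r ^ ((n : ℝ) - 2) * ρb r

/-- Hypothesis (H1): `f_ρ` and `r ↦ r^ν f_ρ(r)` are decreasing on `(0, ε)` for some `ν > 0`. -/
def IsKernelH1 (n : ℕ) (ρb : ℝ → ℝ) (ε : ℝ) : Prop :=
  ∃ ν > (0 : ℝ), AntitoneOn (fRho n ρb) (Ioo 0 ε) ∧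
    AntitoneOn (fun r => r ^ ν * fRho n ρb r) (Ioo 0 ε)

/-- Hypothesis (H2): `f_ρ` is smooth away from the origin and its derivatives satisfy
`|f_ρ^{(k)}(r)| ≤ C(k) r^(-k) f_ρ(r)` on `(0, ε)`. -/
def IsKernelH2 (n : ℕ) (ρb : ℝ → ℝ) (ε : ℝ) : Prop :=
  ContDiffOn ℝ (⊤ : ℕ∞) (fRho n ρb) (Ioi 0) ∧
  ∀ k : ℕ, 0 < k → ∃ C > (0 : ℝ), ∀ r ∈ Ioo (0 : ℝ) ε,
    |iteratedDerivWithin k (fRho n ρb) (Ioi 0) r| ≤ C * r ^ (-(k : ℝ)) * fRho n ρb r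

/-- Hypothesis (H3): `r ↦ r^(n+s-1) ρ̄(r)` is almost decreasing on `(0, ε)` for some `s ∈ (0,1)`. -/
def IsKernelH3 (n : ℕ) (ρb : ℝ → ℝ) (ε : ℝ) : Prop :=
  ∃ s ∈ Ioo (0 : ℝ) 1, ∃ C > (0 : ℝ), ∀ r₁ ∈ Ioo (0 : ℝ) ε, ∀ r₂ ∈ Ioo (0 : ℝ) ε, r₁ ≤ r₂ →
    C * (r₂ ^ ((n : ℝ) + s - 1) * ρb r₂) ≤ r₁ ^ ((n : ℝ) + s - 1) * ρb r₁

/-- Hypothesis (H4): `r ↦ r^(n+t-1) ρ̄(r)` is almost increasing on `(0, ε)` for some `t ∈ (0,1)`. -/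
def IsKernelH4 (n : ℕ) (ρb : ℝ → ℝ) (ε : ℝ) : Prop :=
  ∃ t ∈ Ioo (0 : ℝ) 1, ∃ C > (0 : ℝ), ∀ r₁ ∈ Ioo (0 : ℝ) ε, ∀ r₂ ∈ Ioo (0 : ℝ) ε, r₁ ≤ r₂ →
    C * (r₁ ^ ((n : ℝ) + t - 1) * ρb r₁) ≤ r₂ ^ ((n : ℝ) + t - 1) * ρb r₂

variable {n : ℕ}

/-- Nonlocal gradient of a scalar field:
`D_ρ u(x) = ∫ ((u(x) - u(y))/|x-y|) ((x-y)/|x-y|) ρ(x-y) dy`. -/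
def nlGradS (ρ : Eu n → ℝ) (u : Eu n → ℝ) (x : Eu n) : Eu n :=
  ∫ y, ((u x - u y) * ρ (x - y) / ‖x - y‖ ^ 2) • (x - y)

/-- The (i,j) entry of the integrand of the nonlocal gradient of a vector field. -/
def nlGradMInt (ρ : Eu n → ℝ) (u : Eu n → Eu n) (x : Eu n) (i j : Fin n) : Eu n → ℝ :=
  fun y => (u x - u y) i * (x - y) j * ρ (x - y) / ‖x - y‖ ^ 2

/-- Nonlocal gradient of a vector field, as a matrix:
`D_ρ u(x) = ∫ ((u(x)-u(y))/|x-y|) ⊗ ((x-y)/|x-y|) ρ(x-y) dy`. -/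
def nlGradM (ρ : Eu n → ℝ) (u : Eu n → Eu n) (x : Eu n) : Matrix (Fin n) (Fin n) ℝ :=
  Matrix.of fun i j => ∫ y, nlGradMInt ρ u x i j y

/-- The integrand of the nonlocal divergence of a vector field. -/
def nlDivVInt (ρ : Eu n → ℝ) (u : Eu n → Eu n) (x : Eu n) : Eu n → ℝ :=
  fun y => ⟪u x - u y, x - y⟫_ℝ * ρ (x - y) / ‖x - y‖ ^ 2

/-- Nonlocal divergence of a vector field:
`div_ρ u(x) = ∫ ((u(x)-u(y))·(x-y)/|x-y|²) ρ(x-y) dy`. -/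
def nlDivV (ρ : Eu n → ℝ) (u : Eu n → Eu n) (x : Eu n) : ℝ :=
  ∫ y, nlDivVInt ρ u x y

/-- The i-th component of the integrand of the nonlocal divergence of a matrix field. -/
def nlDivMInt (ρ : Eu n → ℝ) (Φ : Eu n → Matrix (Fin n) (Fin n) ℝ) (x : Eu n) (i : Fin n) :
    Eu n → ℝ :=
  fun y => (∑ j, (Φ x i j - Φ y i j) * (x - y) j) * ρ (x - y) / ‖x - y‖ ^ 2

/-- Nonlocal divergence of a matrix field:
`div_ρ Φ(x) = ∫ ((Φ(x)-Φ(y))/|x-y|) ((x-y)/|x-y|) ρ(x-y) dy ∈ ℝ^n`. -/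
def nlDivM (ρ : Eu n → ℝ) (Φ : Eu n → Matrix (Fin n) (Fin n) ℝ) (x : Eu n) : Eu n :=
  (WithLp.equiv 2 (Fin n → ℝ)).symm fun i => ∫ y, nlDivMInt ρ Φ x i y

/-- Frobenius inner product `A : B = Σ_{ij} a_{ij} b_{ij}` of matrices. -/
def frobInner (A B : Matrix (Fin n) (Fin n) ℝ) : ℝ := ∑ i, ∑ j, A i j * B i j

/-- Symmetric part of a matrix, `M_sym = (M + Mᵀ)/2`. -/
def symPart (M : Matrix (Fin n) (Fin n) ℝ) : Matrix (Fin n) (Fin n) ℝ :=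
  (1 / 2 : ℝ) • (M + Mᵀ)

/-- The potential `Q_ρ(x) = ∫_{|x|}^∞ ρ̄(t)/t dt`. -/
def Qker (n : ℕ) (ρb : ℝ → ℝ) (x : Eu n) : ℝ := ∫ t in Ioi ‖x‖, ρb t / t

/-- Classical Jacobian matrix of a vector field, `(Du)_{ij} = ∂u_i/∂x_j`. -/
def jacobianM (u : Eu n → Eu n) (x : Eu n) : Matrix (Fin n) (Fin n) ℝ :=
  Matrix.of fun i j => fderiv ℝ (fun z => u z i) x (EuclideanSpace.single j 1)

/-- Rank-one matrix `a ⊗ b = (a_i b_j)`. -/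
def tensorP (a b : Eu n) : Matrix (Fin n) (Fin n) ℝ := Matrix.of fun i j => a i * b j

/-- Isotropic elasticity tensor `C[M] = 2μ M_sym + λ (tr M) I`. -/
def isoC (μ lam : ℝ) (M : Matrix (Fin n) (Fin n) ℝ) : Matrix (Fin n) (Fin n) ℝ :=
  (2 * μ) • symPart M + (lam * Matrix.trace M) • (1 : Matrix (Fin n) (Fin n) ℝ)

/-- Fourier transform `𝓕 f(ξ) = ∫ f(x) e^{-2πi x·ξ} dx` of a complex-valued function on ℝ^n. -/
def fInt (f : Eu n → ℂ) (ξ : Eu n) : ℂ :=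
  ∫ x, f x * Complex.exp (-(2 * Real.pi * (⟪x, ξ⟫_ℝ : ℝ) * Complex.I))

/-- The nonlocal Laplacian `(-Δ)_ρ v = -div_ρ (D_ρ v)` of a vector field. -/
def nlLap (ρ : Eu n → ℝ) (v : Eu n → Eu n) (x : Eu n) : Eu n :=
  -nlDivM ρ (fun z => nlGradM ρ v z) x

/-- The i-th component of the integrand of `K_{ρ,φ}(Φ)` from the nonlocal Leibniz rule. -/
def KtermInt (ρ : Eu n → ℝ) (φ : Eu n → ℝ) (Φ : Eu n → Matrix (Fin n) (Fin n) ℝ)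
    (x : Eu n) (i : Fin n) : Eu n → ℝ :=
  fun y => (φ x - φ y) * (∑ j, Φ y i j * (x - y) j) * ρ (x - y) / ‖x - y‖ ^ 2

/-- `K_{ρ,φ}(Φ)(x) = ∫ ((φ(x)-φ(y))/|x-y|) Φ(y) ((x-y)/|x-y|) ρ(x-y) dy`. -/
def Kterm (ρ : Eu n → ℝ) (φ : Eu n → ℝ) (Φ : Eu n → Matrix (Fin n) (Fin n) ℝ)
    (x : Eu n) : Eu n :=
  (WithLp.equiv 2 (Fin n → ℝ)).symm fun i => ∫ y, KtermInt ρ φ Φ x i y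

/-- Classical divergence of a vector field. -/
def divCl (w : Eu n → Eu n) (x : Eu n) : ℝ :=
  ∑ i, fderiv ℝ (fun z => w z i) x (EuclideanSpace.single i 1)

section DifferenceOperator

variable {E : Type*} [NormedAddCommGroup E] [MeasurableSpace E]

/-- The difference operator `u ↦ ∫ (u(x) - u(x-z)) k(z) dz` with kernel `k`. -/
def diffOp (μ : Measure E) (k u : E → ℝ) (x : E) : ℝ := ∫ z, (u x - u (x - z)) * k z ∂μ

/-- The mixed second differences of `u` are bounded by a multiple of the product of the steps. -/
def HasBilinearDiffBound (u : E → ℝ) (C : ℝ) : Prop :=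
  ∀ x z w, |u x - u (x - w) - (u (x - z) - u (x - z - w))| ≤ C * ‖z‖ * ‖w‖

variable {μ : Measure E} {k l u : E → ℝ} {K : NNReal} {C : ℝ} [BorelSpace E]

theorem diffOp_eq_integral_sub [μ.IsAddLeftInvariant] [μ.IsNegInvariant] (x : E) :
    diffOp μ k u x = ∫ y, (u x - u y) * k (x - y) ∂μ := by
  rw [← integral_sub_left_eq_self _ μ x]
  simp [diffOp]

theorem LipschitzWith.integrable_diff_mul (hu : LipschitzWith K u)
    (hkm : AEStronglyMeasurable k μ) (hk : Integrable (fun z => ‖z‖ * k z) μ) (x : E) :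
    Integrable (fun z => (u x - u (x - z)) * k z) μ := by
  have hc := hu.continuous
  refine (hk.norm.const_mul (K : ℝ)).mono'
    ((by fun_prop : Continuous fun z => u x - u (x - z)).aestronglyMeasurable.mul hkm)
    (Filter.Eventually.of_forall fun z => ?_)
  have h := hu.norm_sub_le x (x - z)
  rw [sub_sub_cancel] at h
  simp only [norm_mul, norm_norm, ← mul_assoc]
  gcongr

theorem LipschitzWith.integrable_sub_mul [μ.IsAddLeftInvariant] [μ.IsNegInvariant]
    (hu : LipschitzWith K u)
    (hkm : AEStronglyMeasurable k μ) (hk : Integrable (fun z => ‖z‖ * k z) μ) (x : E) :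
    Integrable (fun y => (u x - u y) * k (x - y)) μ := by
  rw [← integrable_comp_sub_left _ x]
  simpa using hu.integrable_diff_mul hkm hk x

theorem HasBilinearDiffBound.lipschitzWith_diffOp (hC : HasBilinearDiffBound u C)
    (hu : LipschitzWith K u)
    (hkm : AEStronglyMeasurable k μ) (hk : Integrable (fun z => ‖z‖ * k z) μ) :
    LipschitzWith (C * ∫ z, ‖‖z‖ * k z‖ ∂μ).toNNReal (diffOp μ k u) := by
  refine LipschitzWith.of_dist_le' fun x y => ?_
  rw [dist_eq_norm, dist_eq_norm, diffOp, diffOp,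
    ← integral_sub (hu.integrable_diff_mul hkm hk x) (hu.integrable_diff_mul hkm hk y),
    mul_right_comm, ← integral_const_mul]
  refine norm_integral_le_of_norm_le (hk.norm.const_mul _)
    (Filter.Eventually.of_forall fun z => ?_)
  have h := hC x (x - y) z
  rw [sub_sub_cancel] at h
  rw [← sub_mul, norm_mul, norm_mul, norm_norm, ← mul_assoc, Real.norm_eq_abs (_ - _)]
  gcongr

theorem diffOp_comm [SecondCountableTopology E] [SFinite μ]
    (hC : HasBilinearDiffBound u C) (hu : LipschitzWith K u)
    (hkm : AEStronglyMeasurable k μ) (hk : Integrable (fun z => ‖z‖ * k z) μ)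
    (hlm : AEStronglyMeasurable l μ) (hl : Integrable (fun z => ‖z‖ * l z) μ) (x : E) :
    diffOp μ k (diffOp μ l u) x = diffOp μ l (diffOp μ k u) x := by
  have diffOp_diffOp : ∀ {p q : E → ℝ}, AEStronglyMeasurable q μ → Integrable (fun z => ‖z‖ * q z) μ →
      diffOp μ p (diffOp μ q u) x =
        ∫ z, ∫ w, (u x - u (x - w) - (u (x - z) - u (x - z - w))) * (p z * q w) ∂μ ∂μ := by
    intro p q hqm hq
    rw [diffOp]
    congr with z
    rw [diffOp, diffOp, ← integral_sub (hu.integrable_diff_mul hqm hq x)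
      (hu.integrable_diff_mul hqm hq _), ← integral_mul_const]
    congr with w
    ring
  rw [diffOp_diffOp hlm hl, diffOp_diffOp hkm hk, integral_integral_swap]
  · congr with z
    congr with w
    rw [sub_right_comm x z w]
    ring
  · have hc := hu.continuous
    refine ((hk.norm.mul_prod hl.norm).const_mul C).mono'
      ((by fun_prop : Continuous fun p : E × E =>
        u x - u (x - p.2) - (u (x - p.1) - u (x - p.1 - p.2))).aestronglyMeasurable.mul
        (hkm.comp_fst.mul hlm.comp_snd)) (Filter.Eventually.of_forall fun p => ?_)
    have h := hC x p.1 p.2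
    simp only [Function.uncurry, norm_mul, norm_norm, Real.norm_eq_abs (_ - _)]
    calc _ ≤ C * ‖p.1‖ * ‖p.2‖ * (‖k p.1‖ * ‖l p.2‖) := by gcongr
      _ = _ := by ring

theorem diffOp_sum {ι : Type*} (s : Finset ι) {f : ι → E → ℝ} {L : ι → NNReal}
    (hf : ∀ i, LipschitzWith (L i) (f i))
    (hkm : AEStronglyMeasurable k μ) (hk : Integrable (fun z => ‖z‖ * k z) μ) (x : E) :
    diffOp μ k (fun y => ∑ i ∈ s, f i y) x = ∑ i ∈ s, diffOp μ k (f i) x := by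
  simp only [diffOp]
  rw [← integral_finsetSum _ fun i _ => (hf i).integrable_diff_mul hkm hk x]
  simp only [← Finset.sum_sub_distrib, Finset.sum_mul]

end DifferenceOperator

theorem LipschitzWith.hasBilinearDiffBound {E : Type*} [NormedAddCommGroup E] [NormedSpace ℝ E]
    {u : E → ℝ} (hd : Differentiable ℝ u) {K : NNReal} (hK : LipschitzWith K (fderiv ℝ u)) :
    HasBilinearDiffBound u K := by
  intro x z w
  have hder : ∀ y, HasFDerivAt (fun y => u y - u (y - w))
      (fderiv ℝ u y - fderiv ℝ u (y - w)) y := fun y =>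
    (hd y).hasFDerivAt.sub (((hasFDerivAt_comp_sub w).2 (hd (y - w)).hasFDerivAt))
  have h := convex_univ.norm_image_sub_le_of_norm_hasFDerivWithin_le (C := K * ‖w‖)
    (fun y _ => (hder y).hasFDerivWithinAt)
    (fun y _ => by simpa using hK.norm_sub_le y (y - w)) (mem_univ (x - z)) (mem_univ x)
  rw [sub_sub_cancel] at h
  rw [mul_right_comm]
  exact h

theorem LipschitzWith.finsetSum {E ι : Type*} [PseudoEMetricSpace E] (s : Finset ι)
    {f : ι → E → ℝ} {L : ι → NNReal} (hf : ∀ i, LipschitzWith (L i) (f i)) :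
    LipschitzWith (∑ i ∈ s, L i) fun x => ∑ i ∈ s, f i x := by
  classical
  induction s using Finset.induction_on with
  | empty => simp
  | insert i s hi ih => simpa only [Finset.sum_insert hi] using (hf i).add ih

section Kernel

/-- The `j`-th component of the vector kernel `z ↦ ρ(z) z / |z|²`. -/
def gradKernel (ρ : Eu n → ℝ) (j : Fin n) (z : Eu n) : ℝ := z j * ρ z / ‖z‖ ^ 2

theorem aestronglyMeasurable_gradKernel {ρ : Eu n → ℝ} (hρ : AEStronglyMeasurable ρ volume)
    (j : Fin n) : AEStronglyMeasurable (gradKernel ρ j) volume := by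
  have h1 : AEStronglyMeasurable (fun z : Eu n => z j) volume :=
    (by fun_prop : Continuous fun z : Eu n => z j).aestronglyMeasurable
  have h2 : AEStronglyMeasurable (fun z : Eu n => ‖z‖ ^ 2) volume :=
    (by fun_prop : Continuous fun z : Eu n => ‖z‖ ^ 2).aestronglyMeasurable
  exact ((h1.mul hρ).aemeasurable.div h2.aemeasurable).aestronglyMeasurable

theorem integrable_norm_mul_gradKernel {ρ : Eu n → ℝ} (hρ : Integrable ρ volume)
    (j : Fin n) : Integrable (fun z => ‖z‖ * gradKernel ρ j z) volume := by
  refine hρ.norm.mono' (continuous_norm.aestronglyMeasurable.mul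
    (aestronglyMeasurable_gradKernel hρ.1 j)) (Filter.Eventually.of_forall fun z => ?_)
  rcases eq_or_ne z 0 with rfl | hz
  · simp
  · have hz' : 0 < ‖z‖ := norm_pos_iff.2 hz
    have h := PiLp.norm_apply_le z j
    rw [gradKernel, norm_mul, norm_div, norm_mul, norm_pow, norm_norm]
    calc ‖z‖ * (‖z j‖ * ‖ρ z‖ / ‖z‖ ^ 2) ≤ ‖z‖ * (‖z‖ * ‖ρ z‖ / ‖z‖ ^ 2) := by gcongr
      _ = ‖ρ z‖ := by field_simp

theorem nlGradMInt_eq (ρ : Eu n → ℝ) (u : Eu n → Eu n) (x : Eu n) (i j : Fin n) :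
    nlGradMInt ρ u x i j = fun y => (u x i - u y i) * gradKernel ρ j (x - y) := by
  ext y
  simp only [nlGradMInt, gradKernel, PiLp.sub_apply]
  ring

theorem nlDivVInt_eq (ρ : Eu n → ℝ) (u : Eu n → Eu n) (x : Eu n) :
    nlDivVInt ρ u x = fun y => ∑ j, (u x j - u y j) * gradKernel ρ j (x - y) := by
  ext y
  simp only [nlDivVInt, gradKernel, PiLp.inner_apply, PiLp.sub_apply, RCLike.inner_apply,
    conj_trivial, Finset.sum_mul, Finset.sum_div]
  exact Finset.sum_congr rfl fun j _ => by ring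

theorem nlDivMInt_eq (ρ : Eu n → ℝ) (Φ : Eu n → Matrix (Fin n) (Fin n) ℝ) (x : Eu n)
    (i : Fin n) :
    nlDivMInt ρ Φ x i = fun y => ∑ j, (Φ x i j - Φ y i j) * gradKernel ρ j (x - y) := by
  ext y
  simp only [nlDivMInt, gradKernel, PiLp.sub_apply, Finset.sum_mul, Finset.sum_div]
  exact Finset.sum_congr rfl fun j _ => by ring

theorem nlGradM_apply (ρ : Eu n → ℝ) (u : Eu n → Eu n) (x : Eu n) (i j : Fin n) :
    nlGradM ρ u x i j = diffOp volume (gradKernel ρ j) (fun y => u y i) x := by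
  rw [diffOp_eq_integral_sub, nlGradM, Matrix.of_apply, nlGradMInt_eq]

end Kernel

variable (n)

/-- the nonlocal divergence of the transposed nonlocal gradient equals the
nonlocal gradient of the nonlocal divergence. -/
theorem stmt9 (hn : 0 < n) (ρ : Eu n → ℝ) (ρb : ℝ → ℝ) (ε : ℝ)
    (h0 : IsKernelH0 n ρ ρb ε) (hsupp : HasCompactSupport ρ)
    (v : Eu n → Eu n) (hv : ContDiff ℝ (⊤ : ℕ∞) v) (hvs : HasCompactSupport v) (x : Eu n) :
    (∀ i j, Integrable (nlGradMInt ρ v x i j) volume) ∧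
    Integrable (nlDivVInt ρ v x) volume ∧
    (∀ i, Integrable (nlDivMInt ρ (fun z => (nlGradM ρ v z)ᵀ) x i) volume) ∧
    Integrable (fun y =>
      ((nlDivV ρ v x - nlDivV ρ v y) * ρ (x - y) / ‖x - y‖ ^ 2) • (x - y)) volume ∧
    nlDivM ρ (fun z => (nlGradM ρ v z)ᵀ) x = nlGradS ρ (fun z => nlDivV ρ v z) x := by
  have hρ : Integrable ρ volume :=
    (integrableOn_iff_integrable_of_support_subset (subset_tsupport ρ)).1
      (h0.2.2.1.integrableOn_isCompact hsupp)
  have hkm := aestronglyMeasurable_gradKernel hρ.1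
  have hk := integrable_norm_mul_gradKernel hρ
  have hvc : ∀ i, ContDiff ℝ (⊤ : ℕ∞) fun y => v y i := fun i => by fun_prop
  have hvcs : ∀ i, HasCompactSupport fun y => v y i := fun i =>
    hvs.comp_left (g := fun w : Eu n => w i) rfl
  choose K hK using fun i =>
    ContDiff.lipschitzWith_of_hasCompactSupport (hvcs i) (hvc i) (by simp)
  choose L hL using fun i =>
    ContDiff.lipschitzWith_of_hasCompactSupport (𝕂 := ℝ) (n := (⊤ : ℕ∞)) ((hvcs i).fderiv ℝ)
      ((hvc i).fderiv_right (by simp)) (by simp)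
  have hB : ∀ i, HasBilinearDiffBound (fun y => v y i) (L i) := fun i =>
    (hL i).hasBilinearDiffBound ((hvc i).differentiable (by simp))
  have hG : ∀ i j, ∃ M, LipschitzWith M (diffOp volume (gradKernel ρ j) fun y => v y i) :=
    fun i j => ⟨_, (hB i).lipschitzWith_diffOp (hK i) (hkm j) (hk j)⟩
  choose M hM using hG
  have hdiv : nlDivV ρ v = fun z => ∑ j, diffOp volume (gradKernel ρ j) (fun y => v y j) z := by
    ext z
    simp only [nlDivV, nlDivVInt_eq, diffOp_eq_integral_sub]
    exact integral_finsetSum _ fun j _ => (hK j).integrable_sub_mul (hkm j) (hk j) z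
  have hdivL : ∃ N, LipschitzWith N (nlDivV ρ v) := by
    rw [hdiv]
    exact ⟨_, LipschitzWith.finsetSum _ fun j => hM j j⟩
  obtain ⟨N, hN⟩ := hdivL
  have hcomp : ∀ i, (fun y => (((nlDivV ρ v x - nlDivV ρ v y) * ρ (x - y) / ‖x - y‖ ^ 2) •
      (x - y)) i) = fun y => (nlDivV ρ v x - nlDivV ρ v y) * gradKernel ρ i (x - y) := by
    intro i
    ext y
    simp only [PiLp.smul_apply, smul_eq_mul, gradKernel]
    ring
  have hcompI : ∀ i, Integrable (fun y => (((nlDivV ρ v x - nlDivV ρ v y) * ρ (x - y) /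
      ‖x - y‖ ^ 2) • (x - y)) i) volume := fun i => by
    rw [hcomp]
    exact hN.integrable_sub_mul (hkm i) (hk i) x
  refine ⟨fun i j => ?_, ?_, fun i => ?_, Integrable.of_eval_piLp hcompI, ?_⟩
  · rw [nlGradMInt_eq]
    exact (hK i).integrable_sub_mul (hkm j) (hk j) x
  · rw [nlDivVInt_eq]
    exact integrable_finsetSum _ fun j _ => (hK j).integrable_sub_mul (hkm j) (hk j) x
  · simp only [nlDivMInt_eq, Matrix.transpose_apply, nlGradM_apply]
    exact integrable_finsetSum _ fun j _ => (hM j i).integrable_sub_mul (hkm j) (hk j) x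
  · ext i
    rw [nlGradS, eval_integral_piLp hcompI, hcomp, ← diffOp_eq_integral_sub, hdiv,
      diffOp_sum _ (fun j => hM j j) (hkm i) (hk i)]
    simp only [nlDivM, WithLp.equiv_symm_apply, nlDivMInt_eq, Matrix.transpose_apply,
      nlGradM_apply]
    rw [integral_finsetSum _ fun j _ => (hM j i).integrable_sub_mul (hkm j) (hk j) x]
    refine Finset.sum_congr rfl fun j _ => ?_
    rw [← diffOp_eq_integral_sub, diffOp_comm (hB j) (hK j) (hkm j) (hk j) (hkm i) (hk i)]
end
end

section
/- Let ρ satisfy (H0), let φ ∈ C_c^∞(ℝ^n) and Φ ∈ C_c^∞(ℝ^n; ℝ^{n×n}). Then for every x ∈ ℝ^n, all defining integrals converge absolutely and div_ρ (φ Φ)(x) = φ(x) div_ρ Φ(x) + K_{ρ,φ}(Φ)(x), where K_{ρ,φ}(Φ)(x) := ∫_{ℝ^n} ((φ(x) − φ(y))/|x − y|) Φ(y) ((x − y)/|x − y|) ρ(x − y) dy. (Nonlocal Leibniz rule for the nonlocal divergence.) -/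
open MeasureTheory Metric Set Matrix
open scoped ENNReal InnerProductSpace

noncomputable section

variable {n : ℕ}

/-- The weighted difference quotients of a compactly supported `C¹` function against a kernel
with `min{1,|·|⁻¹} ρ` integrable are integrable. -/
theorem integrable_sub_mul_coord_mul_kernel {ρ : Eu n → ℝ}
    (hρ : Integrable (fun x : Eu n => min 1 ‖x‖⁻¹ * ρ x) volume)
    {g : Eu n → ℝ} (hg : ContDiff ℝ 1 g) (hgs : HasCompactSupport g) (x : Eu n) (j : Fin n) :
    Integrable (fun y => (g x - g y) * (x - y) j * ρ (x - y) / ‖x - y‖ ^ 2) volume := by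
  obtain ⟨L, hL⟩ := hg.lipschitzWith_of_hasCompactSupport hgs one_ne_zero
  obtain ⟨B, hB⟩ := hgs.exists_bound_of_continuous hg.continuous
  have hlip (y : Eu n) : |g x - g y| ≤ L * ‖x - y‖ := by
    simpa [Real.dist_eq, dist_eq_norm] using hL.dist_le_mul x y
  have hbdd (y : Eu n) : |g x - g y| ≤ 2 * B := by
    have := norm_sub_le (g x) (g y)
    rw [Real.norm_eq_abs] at this
    linarith [hB x, hB y]
  have hcoord (y : Eu n) : |(x - y) j| ≤ ‖x - y‖ := PiLp.norm_apply_le (x - y) j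
  have hmeas : Measurable fun y : Eu n =>
      (g x - g y) * (x - y) j / (‖x - y‖ ^ 2 * min 1 ‖x - y‖⁻¹) := by
    have := hg.continuous.measurable
    have hj : Measurable fun y : Eu n => (x - y) j := Continuous.measurable (by fun_prop)
    fun_prop
  refine ((hρ.comp_sub_left x).bdd_mul hmeas.aestronglyMeasurable
    (c := max (L : ℝ) (2 * B)) (.of_forall fun y => ?_)).congr (.of_forall fun y => ?_)
  · rcases (norm_nonneg (x - y)).eq_or_lt' with h | h
    · simp [h]
    · have hmin : 0 < min 1 ‖x - y‖⁻¹ := lt_min one_pos (inv_pos.2 h)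
      rw [Real.norm_eq_abs, abs_div, abs_mul, abs_of_pos (by positivity : 0 < ‖x - y‖ ^ 2 * _),
        div_le_iff₀ (by positivity)]
      have hmain : |g x - g y| ≤ max (L : ℝ) (2 * B) * (‖x - y‖ * min 1 ‖x - y‖⁻¹) := by
        rw [mul_min_of_nonneg _ _ h.le, mul_one, mul_inv_cancel₀ h.ne',
          mul_min_of_nonneg _ _ (le_max_of_le_left L.coe_nonneg)]
        refine le_min ((hlip y).trans ?_) ((hbdd y).trans ?_)
        · gcongr
          exact le_max_left _ _
        · rw [mul_one]
          exact le_max_right _ _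
      calc |g x - g y| * |(x - y) j|
          ≤ (max (L : ℝ) (2 * B) * (‖x - y‖ * min 1 ‖x - y‖⁻¹)) * ‖x - y‖ :=
            mul_le_mul hmain (hcoord y) (abs_nonneg _) ((abs_nonneg _).trans hmain)
        _ = _ := by ring
  · rcases (norm_nonneg (x - y)).eq_or_lt' with h | h
    · simp [h]
    · have hmin : 0 < min 1 ‖x - y‖⁻¹ := lt_min one_pos (inv_pos.2 h)
      dsimp only
      field_simp

theorem integrable_nlDivMInt {ρ : Eu n → ℝ}
    (hρ : Integrable (fun x : Eu n => min 1 ‖x‖⁻¹ * ρ x) volume)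
    {Φ : Eu n → Matrix (Fin n) (Fin n) ℝ} (hΦ : ∀ i j, ContDiff ℝ 1 (fun z => Φ z i j))
    (hΦs : ∀ i j, HasCompactSupport (fun z => Φ z i j)) (x : Eu n) (i : Fin n) :
    Integrable (nlDivMInt ρ Φ x i) volume := by
  unfold nlDivMInt
  simp only [Finset.sum_mul, Finset.sum_div]
  exact integrable_finsetSum _ fun j _ =>
    integrable_sub_mul_coord_mul_kernel hρ (hΦ i j) (hΦs i j) x j

/-- Pointwise Leibniz rule for the integrands of the nonlocal divergence. -/
theorem nlDivMInt_smul (ρ φ : Eu n → ℝ) (Φ : Eu n → Matrix (Fin n) (Fin n) ℝ)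
    (x : Eu n) (i : Fin n) (y : Eu n) :
    nlDivMInt ρ (fun z => φ z • Φ z) x i y =
      φ x * nlDivMInt ρ Φ x i y + KtermInt ρ φ Φ x i y := by
  have hsum : ∑ j, ((φ x • Φ x) i j - (φ y • Φ y) i j) * (x - y) j =
      φ x * ∑ j, (Φ x i j - Φ y i j) * (x - y) j +
        (φ x - φ y) * ∑ j, Φ y i j * (x - y) j := by
    rw [Finset.mul_sum, Finset.mul_sum, ← Finset.sum_add_distrib]
    refine Finset.sum_congr rfl fun j _ => ?_
    simp only [Matrix.smul_apply, smul_eq_mul]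
    ring
  simp only [nlDivMInt, KtermInt, hsum]
  ring

variable (n)

/-- nonlocal Leibniz rule for the nonlocal divergence. -/
theorem stmt10 (hn : 0 < n) (ρ : Eu n → ℝ) (ρb : ℝ → ℝ) (ε : ℝ)
    (h0 : IsKernelH0 n ρ ρb ε)
    (φ : Eu n → ℝ) (hφ : ContDiff ℝ (⊤ : ℕ∞) φ) (hφs : HasCompactSupport φ)
    (Φ : Eu n → Matrix (Fin n) (Fin n) ℝ)
    (hΦ : ∀ i j, ContDiff ℝ (⊤ : ℕ∞) (fun z => Φ z i j))
    (hΦs : ∀ i j, HasCompactSupport (fun z => Φ z i j)) (x : Eu n) :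
    (∀ i, Integrable (nlDivMInt ρ (fun z => φ z • Φ z) x i) volume) ∧
    (∀ i, Integrable (nlDivMInt ρ Φ x i) volume) ∧
    (∀ i, Integrable (KtermInt ρ φ Φ x i) volume) ∧
    nlDivM ρ (fun z => φ z • Φ z) x = φ x • nlDivM ρ Φ x + Kterm ρ φ Φ x := by
  have hρ := h0.2.2.2.1
  have hone : (1 : WithTop ℕ∞) ≤ ((⊤ : ℕ∞) : WithTop ℕ∞) := by exact_mod_cast le_top
  have hprod (i) : Integrable (nlDivMInt ρ (fun z => φ z • Φ z) x i) volume :=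
    integrable_nlDivMInt hρ (fun i j => (hφ.mul (hΦ i j)).of_le hone)
      (fun i j => hφs.mul_right (f' := fun z => Φ z i j)) x i
  have hdiv (i) : Integrable (nlDivMInt ρ Φ x i) volume :=
    integrable_nlDivMInt hρ (fun i j => (hΦ i j).of_le hone) hΦs x i
  have hK (i) : Integrable (KtermInt ρ φ Φ x i) volume := by
    refine ((hprod i).sub ((hdiv i).const_mul (φ x))).congr (.of_forall fun y => ?_)
    simp [nlDivMInt_smul]
  refine ⟨hprod, hdiv, hK, ?_⟩
  ext i
  simp only [nlDivM, Kterm, WithLp.equiv_symm_apply, PiLp.add_apply, PiLp.smul_apply, smul_eq_mul,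
    nlDivMInt_smul]
  rw [integral_add ((hdiv i).const_mul _) (hK i), integral_const_mul]
end
end
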